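/- Let G be a combinatorial pseudo-triangulation with the generalized Laman property. Then every subgraph H of G with at least three vertices has at least three corners. -/

import Mathlib

/-! ## Combinatorial plane graphs via rotation systems -/

/-- The permutation of darts of a simple graph reversing each dart. -/
def dartSymmPerm {V : Type} (G : SimpleGraph V) : Equiv.Perm G.Dart where
  toFun := SimpleGraph.Dart.symm
  invFun := SimpleGraph.Dart.symm
  left_inv d := SimpleGraph.Dart.symm_symm d
  right_inv d := SimpleGraph.Dart.symm_symm d

/-- The setoid on `α` whose classes are the cycles (orbits) of a permutation `σ`. -/
def faceSetoid {α : Type} (σ : Equiv.Perm α) : Setoid α :=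
  ⟨σ.SameCycle, ⟨fun x => Equiv.Perm.SameCycle.refl σ x,
    fun h => h.symm, fun h h' => h.trans h'⟩⟩

/-- A (topological, non-crossing) embedding of a connected graph `G` in the plane, encoded
combinatorially: a rotation system (the counterclockwise cyclic order of the darts around
each vertex), which is planar in the sense of Euler's formula (the number of orbits of the
face permutation `rot * symm` is the number of faces), together with a distinguished
outer (unbounded) face.  A *plane graph* is a graph `G` together with such a structure. -/
structure PlaneEmb {V : Type} (G : SimpleGraph V) where
  rot : Equiv.Perm G.Dart
  rot_fst : ∀ d : G.Dart, (rot d).fst = d.fst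
  rot_vertex : ∀ d d' : G.Dart, d.fst = d'.fst → ∃ n : ℕ, (rot ^ n) d = d'
  connected : G.Connected
  outer : Quotient (faceSetoid (rot * dartSymmPerm G))
  euler : Nat.card V + Nat.card (Quotient (faceSetoid (rot * dartSymmPerm G)))
      = Nat.card G.edgeSet + 2

namespace PlaneEmb

variable {V : Type} {G : SimpleGraph V}

/-- The faces of a plane graph: orbits of the face permutation. -/
abbrev Face (E : PlaneEmb G) : Type := Quotient (faceSetoid (E.rot * dartSymmPerm G))

/-- The face having the dart `d` on its contour. -/
def dartFace (E : PlaneEmb G) (d : G.Dart) : E.Face :=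
  Quotient.mk (faceSetoid (E.rot * dartSymmPerm G)) d

/-- Each dart `d` determines an *angle* of the plane graph, namely the angle at the vertex
`d.fst` between the edges of `d` and `rot d`; `E.angleFace d` is the face this angle lies in. -/
def angleFace (E : PlaneEmb G) (d : G.Dart) : E.Face :=
  Quotient.mk (faceSetoid (E.rot * dartSymmPerm G)) d.symm

end PlaneEmb

/-- A vertex is *pointed* (w.r.t. an assignment `big` of which angles are labelled big)
if some angle at it is labelled big. -/
def PointedVx {V : Type} {G : SimpleGraph V} (big : G.Dart → Prop) (v : V) : Prop :=
  ∃ d : G.Dart, big d ∧ d.fst = v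

/-- A *combinatorial pseudo-triangulation labelling* (CPT-labelling): every bounded face has
exactly three small angles, all angles of the unbounded face are big, and no vertex is
incident to more than one big angle. -/
structure IsCPTLabelling {V : Type} {G : SimpleGraph V} (E : PlaneEmb G)
    (big : G.Dart → Prop) : Prop where
  bounded_small : ∀ F : E.Face, F ≠ E.outer →
    Nat.card {d : G.Dart | E.angleFace d = F ∧ ¬ big d} = 3
  outer_big : ∀ d : G.Dart, E.angleFace d = E.outer → big d
  one_big : ∀ d d' : G.Dart, big d → big d' → d.fst = d'.fst → d = d'

/-- The generalized Laman property of a combinatorial pseudo-triangulation: any `x` non-pointed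
plus `y` pointed vertices, with `x + y ≥ 2`, induce at most `3x + 2y - 3` edges. -/
def GenLaman {V : Type} (G : SimpleGraph V) (big : G.Dart → Prop) : Prop :=
  ∀ S : Set V, 2 ≤ Nat.card S →
    (Nat.card ((G.induce S).edgeSet) : ℤ) ≤
      3 * Nat.card {v ∈ S | ¬ PointedVx big v} + 2 * Nat.card {v ∈ S | PointedVx big v} - 3

/-! ## Rigidity -/

/-- Dot product in the plane. -/
def dot2 (u w : ℝ × ℝ) : ℝ := u.1 * w.1 + u.2 * w.2

/-- Rotation by 90 degrees. -/
def rot90 (u : ℝ × ℝ) : ℝ × ℝ := (-u.2, u.1)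

/-- `q` is an infinitesimal motion of the bar-and-joint framework `(G, p)`. -/
def IsInfMotion {V : Type} (G : SimpleGraph V) (p q : V → ℝ × ℝ) : Prop :=
  ∀ u v : V, G.Adj u v → dot2 (p u - p v) (q u - q v) = 0

/-- Trivial infinitesimal motions: those coming from rigid motions of the plane
(infinitesimal rotations and translations). -/
def IsTrivialMotion {V : Type} (p q : V → ℝ × ℝ) : Prop :=
  ∃ (a : ℝ) (t : ℝ × ℝ), ∀ v : V, q v = a • rot90 (p v) + t

/-- The framework `(G, p)` is infinitesimally rigid: it has no non-trivial infinitesimal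
motions. -/
def InfRigid {V : Type} (G : SimpleGraph V) (p : V → ℝ × ℝ) : Prop :=
  ∀ q : V → ℝ × ℝ, IsInfMotion G p q → IsTrivialMotion p q

/-- A configuration of points is *generic* if its coordinates are algebraically
independent over `ℚ`. -/
def GenericConf {V : Type} (p : V → ℝ × ℝ) : Prop :=
  AlgebraicIndependent ℚ (fun x : V ⊕ V => Sum.elim (fun v => (p v).1) (fun v => (p v).2) x)

/-- A graph is *generically rigid in the plane* if every generic framework on it has no
non-trivial infinitesimal motions. -/
def GenRigid {V : Type} (G : SimpleGraph V) : Prop :=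
  ∀ p : V → ℝ × ℝ, GenericConf p → InfRigid G p

/-- A graph is *isostatic* (generically minimally rigid) if it is generically rigid and
removing any edge destroys generic rigidity. -/
def Isostatic {V : Type} (G : SimpleGraph V) : Prop :=
  GenRigid G ∧ ∀ e ∈ G.edgeSet, ¬ GenRigid (G.deleteEdges {e})

/-- Laman's condition: exactly `2n - 3` edges, and every `k ≥ 2` vertices span at most
`2k - 3` edges. -/
def LamanGraph {V : Type} (L : SimpleGraph V) : Prop :=
  (Nat.card L.edgeSet : ℤ) = 2 * Nat.card V - 3 ∧
  ∀ S : Set V, 2 ≤ Nat.card S →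
    (Nat.card ((L.induce S).edgeSet) : ℤ) ≤ 2 * Nat.card S - 3

/-! ## Geometry: straight-line drawings, angles, stretching -/

/-- The counterclockwise angle from the direction `u` to the direction `w`,
normalized to lie in `(0, 2π]` (a full turn for `w` pointing in the direction of `u`). -/
noncomputable def ccwAngle (u w : ℝ × ℝ) : ℝ :=
  if 0 < Complex.arg ((⟨w.1, w.2⟩ : ℂ) / (⟨u.1, u.2⟩ : ℂ)) then
    Complex.arg ((⟨w.1, w.2⟩ : ℂ) / (⟨u.1, u.2⟩ : ℂ))
  else Complex.arg ((⟨w.1, w.2⟩ : ℂ) / (⟨u.1, u.2⟩ : ℂ)) + 2 * Real.pi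

/-- The (counterclockwise) geometric angle, in the straight-line drawing `p`, of the angle of
the dart `d`, i.e. the angle at `d.fst` between the edge of `d` and the edge of `rot d`. -/
noncomputable def dartAngle {V : Type} {G : SimpleGraph V} (E : PlaneEmb G)
    (p : V → ℝ × ℝ) (d : G.Dart) : ℝ :=
  ccwAngle (p d.snd - p d.fst) (p (E.rot d).snd - p (E.rot d).fst)

/-- A straight-line drawing is non-crossing: distinct edges meet only in common endpoints,
and no vertex lies on an edge not incident to it. -/
def NonCrossing {V : Type} (G : SimpleGraph V) (p : V → ℝ × ℝ) : Prop :=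
  (∀ a b c d : V, G.Adj a b → G.Adj c d → ({a, b} : Set V) ≠ {c, d} →
    segment ℝ (p a) (p b) ∩ segment ℝ (p c) (p d) ⊆ p '' ({a, b} ∩ {c, d} : Set V)) ∧
  (∀ x a b : V, G.Adj a b → x ≠ a → x ≠ b → p x ∉ segment ℝ (p a) (p b))

/-- The points of the drawing are in general position: no three of them are collinear. -/
def GenPos {V : Type} (p : V → ℝ × ℝ) : Prop :=
  ∀ u v w : V, u ≠ v → u ≠ w → v ≠ w → ¬ Collinear ℝ ({p u, p v, p w} : Set (ℝ × ℝ))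

/-- The straight-line drawing `p` realizes the plane graph `(G, E)`: it is injective and
non-crossing, and around every (non-isolated) vertex the counterclockwise angles between
rotation-consecutive darts sum to `2π`, so the drawing induces the given rotation system. -/
def RealizesEmb {V : Type} [Fintype V] [DecidableEq V] (G : SimpleGraph V)
    [DecidableRel G.Adj] (E : PlaneEmb G) (p : V → ℝ × ℝ) : Prop :=
  Function.Injective p ∧ NonCrossing G p ∧
  ∀ v : V, (∃ d : G.Dart, d.fst = v) →
    ∑ d ∈ Finset.univ.filter (fun d : G.Dart => d.fst = v), dartAngle E p d = 2 * Real.pi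

/-- The drawing `p` *stretches* the angle labelling `big` of the plane graph `(G, E)`:
it realizes the embedding, has its (finitely many) vertices in general position, and every
angle labelled big is reflex (> 180°) while every angle labelled small is convex (< 180°).
If `big` is a CPT-labelling this makes `p` a pseudo-triangulation of its vertex set:
every bounded face is a pseudo-triangle and the convex hull edges are present. -/
def Stretches {V : Type} [Fintype V] [DecidableEq V] (G : SimpleGraph V)
    [DecidableRel G.Adj] (E : PlaneEmb G) (big : G.Dart → Prop) (p : V → ℝ × ℝ) : Prop :=
  RealizesEmb G E p ∧ GenPos p ∧
  ∀ d : G.Dart, (big d → Real.pi < dartAngle E p d) ∧ (¬ big d → dartAngle E p d < Real.pi)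

/-- The drawing `p` makes the plane graph `(G, E)` a pseudo-triangulation of its vertex set
(with the given embedding): for the labelling of the angles of the drawing as big (reflex)
or small (convex), every bounded face has exactly three small angles (is a pseudo-triangle)
and all outer angles are big (so the convex hull edges are present). -/
def StretchesToPT {V : Type} [Fintype V] [DecidableEq V] (G : SimpleGraph V)
    [DecidableRel G.Adj] (E : PlaneEmb G) (p : V → ℝ × ℝ) : Prop :=
  ∃ big : G.Dart → Prop, IsCPTLabelling E big ∧ Stretches G E big p

/-- A vertex `v` of a geometric straight-line drawing is *pointed* if all the edges at `v`
lie in a closed half-plane supported at `v`. -/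
def GeoPointed {V : Type} (G : SimpleGraph V) (p : V → ℝ × ℝ) (v : V) : Prop :=
  ∃ u : ℝ × ℝ, u ≠ 0 ∧ ∀ w : V, G.Adj v w → 0 ≤ dot2 u (p w - p v)

/-! ## Subgraphs, outer face, corners -/

/-- One step of dual connectivity avoiding the edge set `A`: the faces `F`, `F'` are the two
sides of some edge of `G` not belonging to `A`. -/
def FaceStep {V : Type} {G : SimpleGraph V} (E : PlaneEmb G) (A : Set (Sym2 V)) :
    E.Face → E.Face → Prop :=
  fun F F' => ∃ d : G.Dart, E.dartFace d = F ∧ E.dartFace d.symm = F' ∧ d.edge ∉ A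

/-- The face `F` of `G` is contained in the outer (unbounded) face of the plane subgraph of
`G` with edge set `A`: `F` can reach the outer face of `G` in the dual graph without
crossing the edges of `A`. -/
def InOuterOf {V : Type} {G : SimpleGraph V} (E : PlaneEmb G) (A : Set (Sym2 V))
    (F : E.Face) : Prop :=
  Relation.ReflTransGen (FaceStep E A) F E.outer

/-- `v` is a *corner* of the subgraph `H` of the combinatorial pseudo-triangulation
`(G, E, big)`: either `v` is pointed in `G` and its big angle is contained in the
outer face of `H`, or `v` is non-pointed in `G` and two consecutive (small) angles at `v`
are contained in the outer face of `H`. -/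
def IsCPTCorner {V : Type} {G : SimpleGraph V} (E : PlaneEmb G) (big : G.Dart → Prop)
    (H : G.Subgraph) (v : V) : Prop :=
  (v ∈ H.verts ∧ ∃ d : G.Dart, big d ∧ d.fst = v ∧ InOuterOf E H.edgeSet (E.angleFace d)) ∨
  (v ∈ H.verts ∧ ¬ PointedVx big v ∧ ∃ d : G.Dart, d.fst = v ∧
    InOuterOf E H.edgeSet (E.angleFace d) ∧ InOuterOf E H.edgeSet (E.angleFace (E.rot d)) ∧
    (E.rot d).edge ∉ H.edgeSet)

/-- A plane graph has *non-degenerate faces* if no edge appears twice on the contour cycle of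
a face, i.e. the edges incident to every face form a simple closed cycle. -/
def NonDegenerateFaces {V : Type} {G : SimpleGraph V} (E : PlaneEmb G) : Prop :=
  ∀ d : G.Dart, ¬ (E.rot * dartSymmPerm G).SameCycle d d.symm



section PlanarBound

open Classical in
/-- boundary map -/
noncomputable def bdry {V : Type} [Fintype V] (G : SimpleGraph V) :
    (G.edgeSet → ZMod 2) →ₗ[ZMod 2] (V → ZMod 2) where
  toFun g v := ∑ d : G.Dart, if d.fst = v then g ⟨d.edge, d.edge_mem⟩ else 0
  map_add' g h := by
    funext v
    simp only [Pi.add_apply, ← Finset.sum_add_distrib]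
    refine Finset.sum_congr rfl fun d _ => ?_
    split_ifs <;> simp
  map_smul' c g := by
    funext v
    simp only [Pi.smul_apply, smul_eq_mul, RingHom.id_apply, Finset.mul_sum]
    refine Finset.sum_congr rfl fun d _ => ?_
    split_ifs <;> simp

theorem bdry_apply {V : Type} [Fintype V] (G : SimpleGraph V) [Fintype G.Dart] [DecidableEq V]
    (g : G.edgeSet → ZMod 2) (v : V) :
    bdry G g v = ∑ d : G.Dart, if d.fst = v then g ⟨d.edge, d.edge_mem⟩ else 0 := by
  simp only [bdry, LinearMap.coe_mk, AddHom.coe_mk]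
  convert rfl

theorem exists_dart_edge {V : Type} {G : SimpleGraph V} (e : G.edgeSet) :
    ∃ d : G.Dart, d.edge = e.1 := by
  obtain ⟨e, he⟩ := e
  induction e using Sym2.ind with
  | _ a b => exact ⟨⟨(a, b), he⟩, rfl⟩

/-- coboundary map on faces -/
noncomputable def cobd {V : Type} {G : SimpleGraph V} (E : PlaneEmb G) :
    (E.Face → ZMod 2) →ₗ[ZMod 2] (G.edgeSet → ZMod 2) where
  toFun f e := f (E.dartFace (exists_dart_edge e).choose)
    + f (E.dartFace (exists_dart_edge e).choose.symm)
  map_add' g h := by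
    funext v
    simp only [Pi.add_apply]; ring
  map_smul' c g := by
    funext v
    simp only [Pi.smul_apply, smul_eq_mul, RingHom.id_apply]; ring

theorem cobd_apply {V : Type} {G : SimpleGraph V} (E : PlaneEmb G) (f : E.Face → ZMod 2)
    (d : G.Dart) : cobd E f ⟨d.edge, d.edge_mem⟩ = f (E.dartFace d) + f (E.dartFace d.symm) := by
  have h := (exists_dart_edge (G := G) ⟨d.edge, d.edge_mem⟩).choose_spec
  change f (E.dartFace (exists_dart_edge (G := G) ⟨d.edge, d.edge_mem⟩).choose)
    + f (E.dartFace (exists_dart_edge (G := G) ⟨d.edge, d.edge_mem⟩).choose.symm) = _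
  rcases (SimpleGraph.dart_edge_eq_iff _ _).1 h with h | h
  · rw [h]
  · rw [h, SimpleGraph.Dart.symm_symm, add_comm]

theorem dartFace_rot {V : Type} {G : SimpleGraph V} (E : PlaneEmb G) (d : G.Dart) :
    E.dartFace (E.rot d) = E.dartFace d.symm := by
  apply Quotient.sound
  change (E.rot * dartSymmPerm G).SameCycle _ _
  have : (E.rot * dartSymmPerm G) d.symm = E.rot d := by
    simp [dartSymmPerm, Equiv.Perm.mul_apply]
  rw [← this]
  exact (Equiv.Perm.SameCycle.refl _ _).apply_left

theorem bdry_cobd {V : Type} [Fintype V] {G : SimpleGraph V} (E : PlaneEmb G)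
    (f : E.Face → ZMod 2) : bdry G (cobd E f) = 0 := by
  classical
  funext v
  rw [bdry_apply, Pi.zero_apply]
  have h1 : ∀ d : G.Dart, (if d.fst = v then cobd E f ⟨d.edge, d.edge_mem⟩ else 0)
      = (if d.fst = v then f (E.dartFace d) else 0)
        + (if (E.rot d).fst = v then f (E.dartFace (E.rot d)) else 0) := by
    intro d
    rw [cobd_apply, E.rot_fst, dartFace_rot]
    split_ifs <;> simp
  rw [Finset.sum_congr rfl (fun d _ => h1 d), Finset.sum_add_distrib,
    Equiv.sum_comp E.rot (fun d => if d.fst = v then f (E.dartFace d) else 0)]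
  exact CharTwo.add_self_eq_zero _

theorem rot_closed {V : Type} {G : SimpleGraph V} (E : PlaneEmb G) (P : G.Dart → Prop)
    (h : ∀ d, P d → P (E.rot d)) (d d' : G.Dart) (hd : d.fst = d'.fst) (hP : P d) : P d' := by
  obtain ⟨n, rfl⟩ := E.rot_vertex d d' hd
  have : ∀ n : ℕ, P ((E.rot ^ n) d) := by
    intro n
    induction n with
    | zero => simpa using hP
    | succ n ih => rw [pow_succ', Equiv.Perm.mul_apply]; exact h _ ih
  exact this n

theorem dart_connected {V : Type} {G : SimpleGraph V} (E : PlaneEmb G) (P : G.Dart → Prop)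
    (h : ∀ d, P d → P (E.rot d)) (hs : ∀ d, P d → P d.symm) (d d' : G.Dart) (hP : P d) : P d' := by
  have key : ∀ u v : V, G.Walk u v → (∀ e : G.Dart, e.fst = u → P e) →
      ∀ e : G.Dart, e.fst = v → P e := by
    intro u v w
    induction w with
    | nil => exact fun h => h
    | cons hadj w ih =>
      intro hu
      apply ih
      intro e he
      have h1 := hs _ (hu ⟨(_, _), hadj⟩ rfl)
      exact rot_closed E P h _ e he.symm h1
  obtain ⟨w⟩ := E.connected.preconnected d.fst d'.fst
  exact key _ _ w (fun e he => rot_closed E P h d e he.symm hP) d' rfl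

theorem cobd_ker {V : Type} {G : SimpleGraph V} (E : PlaneEmb G)
    (f : E.Face → ZMod 2) (hf : cobd E f = 0) (F : E.Face) : f F = f E.outer := by
  have hsymm : ∀ d : G.Dart, f (E.dartFace d.symm) = f (E.dartFace d) := by
    intro d
    have := congrFun hf ⟨d.edge, d.edge_mem⟩
    rw [cobd_apply] at this
    exact (CharTwo.add_eq_zero.1 this).symm
  obtain ⟨d, rfl⟩ := Quotient.exists_rep F
  obtain ⟨d', hd'⟩ := Quotient.exists_rep E.outer
  rw [← hd']
  change f (E.dartFace d) = f (E.dartFace d')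
  refine (dart_connected E (fun e => f (E.dartFace e) = f (E.dartFace d)) ?_ ?_ d d' rfl).symm
  · intro e he
    change f (E.dartFace (E.rot e)) = _
    rw [dartFace_rot, hsymm, he]
  · intro e he
    change f (E.dartFace e.symm) = _
    rw [hsymm, he]

theorem bdry_single {V : Type} [Fintype V] [DecidableEq V] {G : SimpleGraph V} (d : G.Dart) :
    bdry G (Pi.single ⟨d.edge, d.edge_mem⟩ 1) = Pi.single d.fst 1 + Pi.single d.snd 1 := by
  classical
  funext v
  rw [bdry_apply]
  have hne : d ≠ d.symm := (SimpleGraph.Dart.symm_ne d).symm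
  have : ∀ d' : G.Dart, (if d'.fst = v then (Pi.single (M := fun _ => ZMod 2) (⟨d.edge, d.edge_mem⟩ : G.edgeSet) 1 :
    G.edgeSet → ZMod 2) ⟨d'.edge, d'.edge_mem⟩ else 0) =
      (if d' = d then (if d.fst = v then 1 else 0) else 0)
      + (if d' = d.symm then (if d.snd = v then 1 else 0) else 0) := by
    intro d'
    by_cases h1 : d' = d
    · subst h1
      simp [hne]
    · by_cases h2 : d' = d.symm
      · subst h2
        have : (⟨d.symm.edge, d.symm.edge_mem⟩ : G.edgeSet) = ⟨d.edge, d.edge_mem⟩ :=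
          Subtype.ext (SimpleGraph.Dart.edge_symm d)
        rw [this]
        simp [hne.symm]
      · have h3 : (⟨d'.edge, d'.edge_mem⟩ : G.edgeSet) ≠ ⟨d.edge, d.edge_mem⟩ := by
          intro h
          rcases (SimpleGraph.dart_edge_eq_iff _ _).1 (Subtype.ext_iff.1 h) with h | h
          · exact h1 h
          · exact h2 h
        simp [h1, h2, Pi.single_eq_of_ne h3]
  rw [Finset.sum_congr rfl (fun d' _ => this d'), Finset.sum_add_distrib]
  simp [Pi.single_apply, eq_comm]

theorem bdry_rank {V : Type} [Fintype V] {G : SimpleGraph V} (hG : G.Connected) :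
    Nat.card V ≤ Module.finrank (ZMod 2) (LinearMap.range (bdry G)) + 1 := by
  classical
  have cz : ∀ x : V → ZMod 2, x + x = 0 := fun x => funext fun v => CharTwo.add_self_eq_zero (x v)
  obtain ⟨v0⟩ := hG.nonempty
  have key : ∀ u v : V, G.Walk u v →
      (Pi.single u 1 + Pi.single v 1 : V → ZMod 2) ∈ LinearMap.range (bdry G) := by
    intro u v w
    induction w with
    | nil => rw [cz]; exact Submodule.zero_mem _
    | @cons u v w hadj p ih =>
      have h1 : (Pi.single u 1 + Pi.single v 1 : V → ZMod 2) ∈ LinearMap.range (bdry G) :=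
        ⟨_, bdry_single ⟨(u, v), hadj⟩⟩
      have h2 := Submodule.add_mem _ h1 ih
      have h3 : (Pi.single u 1 + Pi.single v 1 + (Pi.single v 1 + Pi.single w 1) : V → ZMod 2)
        = Pi.single u 1 + Pi.single w 1 := by
        rw [add_assoc, ← add_assoc (Pi.single v 1), cz, zero_add]
      rwa [h3] at h2
  have htop : LinearMap.range (bdry G) ⊔ Submodule.span (ZMod 2) {(Pi.single v0 1 : V → ZMod 2)} = ⊤ := by
    rw [eq_top_iff]
    intro x _
    rw [pi_eq_sum_univ' x]
    refine Submodule.sum_mem _ fun i _ => Submodule.smul_mem _ _ ?_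
    obtain ⟨w⟩ := hG.preconnected i v0
    have h1 := key _ _ w
    have h2 : (Pi.single v0 1 : V → ZMod 2) ∈ Submodule.span (ZMod 2) {(Pi.single v0 1 : V → ZMod 2)} :=
      Submodule.mem_span_singleton_self _
    have h3 := Submodule.add_mem_sup h1 h2
    rw [add_assoc, cz, add_zero] at h3
    convert h3 using 1
  have h1 := Submodule.finrank_add_le_finrank_add_finrank (LinearMap.range (bdry G))
    (Submodule.span (ZMod 2) {(Pi.single v0 1 : V → ZMod 2)})
  rw [htop, finrank_top, Module.finrank_fintype_fun_eq_card] at h1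
  have h2 : Module.finrank (ZMod 2) (Submodule.span (ZMod 2) {(Pi.single v0 1 : V → ZMod 2)}) ≤ 1 := by
    have := finrank_span_le_card (R := ZMod 2) ({(Pi.single v0 1 : V → ZMod 2)} : Set (V → ZMod 2))
    simpa using this
  rw [Nat.card_eq_fintype_card]
  omega

instance {V : Type} [Fintype V] {G : SimpleGraph V} : Finite G.Dart := by
  classical
  infer_instance

theorem exact_cobd {V : Type} [Fintype V] {G : SimpleGraph V} (E : PlaneEmb G) :
    LinearMap.range (cobd E) = LinearMap.ker (bdry G) := by
  classical
  have : Finite E.Face := Quotient.finite _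
  have := Fintype.ofFinite E.Face
  apply Submodule.eq_of_le_of_finrank_le
  · rintro _ ⟨f, rfl⟩
    exact bdry_cobd E f
  · have h1 := LinearMap.finrank_range_add_finrank_ker (bdry G)
    have h2 := LinearMap.finrank_range_add_finrank_ker (cobd E)
    have h3 := bdry_rank E.connected
    have h4 := E.euler
    rw [Module.finrank_fintype_fun_eq_card, ← Nat.card_eq_fintype_card] at h1 h2
    have h5 : Module.finrank (ZMod 2) (LinearMap.ker (cobd E)) ≤ 1 := by
      have hle : LinearMap.ker (cobd E) ≤ Submodule.span (ZMod 2) {(fun _ => 1 : E.Face → ZMod 2)} := by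
        intro f hf
        rw [Submodule.mem_span_singleton]
        refine ⟨f E.outer, ?_⟩
        funext F
        simp [cobd_ker E f hf F]
      have := finrank_span_le_card (R := ZMod 2) ({(fun _ => 1 : E.Face → ZMod 2)} : Set (E.Face → ZMod 2))
      have h6 := Submodule.finrank_mono hle
      simp at this
      omega
    have h7 : Nat.card (Quotient (faceSetoid (E.rot * dartSymmPerm G))) = Nat.card E.Face := rfl
    omega

open Classical in
/-- extension by zero -/
noncomputable def extZ {α : Type} (S : Set α) : (S → ZMod 2) →ₗ[ZMod 2] (α → ZMod 2) where
  toFun g a := if h : a ∈ S then g ⟨a, h⟩ else 0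
  map_add' g h := by
    funext a
    simp only [Pi.add_apply]
    split_ifs <;> simp
  map_smul' c g := by
    funext a
    simp only [Pi.smul_apply, smul_eq_mul, RingHom.id_apply]
    split_ifs <;> simp

theorem extZ_of_not {α : Type} (S : Set α) (g : S → ZMod 2) (a : α) (h : a ∉ S) :
    extZ S g a = 0 := by simp [extZ, h]

theorem extZ_of_mem {α : Type} (S : Set α) (g : S → ZMod 2) (a : α) (h : a ∈ S) :
    extZ S g a = g ⟨a, h⟩ := by simp [extZ, h]

theorem planar_bound {V : Type} [Fintype V] {G : SimpleGraph V} (E : PlaneEmb G)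
    (A : Set G.edgeSet) (Bs : Set E.Face) (T : Set V)
    (hB : ∀ f : E.Face → ZMod 2, (∀ d : G.Dart, (⟨d.edge, d.edge_mem⟩ : G.edgeSet) ∉ A →
      f (E.dartFace d) = f (E.dartFace d.symm)) → ∀ F ∉ Bs, f F = f E.outer)
    (hT : ∀ g : G.edgeSet → ZMod 2, (∀ e ∉ A, g e = 0) → (∀ v ∈ T, bdry G g v = 0) →
      bdry G g = 0) : Nat.card A ≤ Nat.card Bs + Nat.card T := by
  classical
  have : Finite E.Face := Quotient.finite _
  have := Fintype.ofFinite Bs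
  have := Fintype.ofFinite A
  have := Fintype.ofFinite T
  let Ψ : (A → ZMod 2) →ₗ[ZMod 2] (T → ZMod 2) :=
    (LinearMap.funLeft (ZMod 2) (ZMod 2) (fun t : T => (t : V))) ∘ₗ (bdry G) ∘ₗ (extZ A)
  let Φ : (Bs → ZMod 2) →ₗ[ZMod 2] (A → ZMod 2) :=
    (LinearMap.funLeft (ZMod 2) (ZMod 2) (fun t : A => (t : G.edgeSet))) ∘ₗ (cobd E) ∘ₗ (extZ Bs)
  have hle : LinearMap.ker Ψ ≤ LinearMap.range Φ := by
    intro g hg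
    have h0 : bdry G (extZ A g) = 0 := by
      refine hT _ (fun e he => extZ_of_not A g e he) ?_
      intro v hv
      exact congrFun (LinearMap.mem_ker.1 hg) ⟨v, hv⟩
    have h1 : extZ A g ∈ LinearMap.range (cobd E) := by
      rw [exact_cobd]; exact h0
    obtain ⟨f, hf⟩ := h1
    have hconst := hB f (by
      intro d hd
      have := congrFun hf ⟨d.edge, d.edge_mem⟩
      rw [cobd_apply, extZ_of_not _ _ _ hd] at this
      exact CharTwo.add_eq_zero.1 this)
    refine ⟨fun F => f F + f E.outer, ?_⟩
    have hext : extZ Bs (fun F => f F + f E.outer) = fun F => f F + f E.outer := by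
      funext F
      by_cases hF : F ∈ Bs
      · rw [extZ_of_mem _ _ _ hF]
      · rw [extZ_of_not _ _ _ hF, hconst F hF, CharTwo.add_self_eq_zero]
    funext e
    change cobd E (extZ Bs (fun F => f F + f E.outer)) e.1 = g e
    rw [hext]
    have h2 := congrFun hf e.1
    rw [extZ_of_mem _ _ _ e.2] at h2
    rw [← h2]
    obtain ⟨⟨e, he⟩, heA⟩ := e
    obtain ⟨d, hd⟩ := exists_dart_edge ⟨e, he⟩
    obtain rfl : d.edge = e := hd
    change cobd E _ ⟨d.edge, d.edge_mem⟩ = cobd E _ ⟨d.edge, d.edge_mem⟩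
    rw [cobd_apply, cobd_apply]
    have := CharTwo.add_self_eq_zero (f E.outer)
    linear_combination this
  have h1 := LinearMap.finrank_range_add_finrank_ker Ψ
  have h2 := Submodule.finrank_le (LinearMap.range Ψ)
  have h3 := Submodule.finrank_mono hle
  have h4 := LinearMap.finrank_range_le Φ
  rw [Module.finrank_fintype_fun_eq_card, ← Nat.card_eq_fintype_card] at h1 h2 h4
  omega

end PlanarBound

section Counting

open Classical in
/-- counting -/
noncomputable def cnt {α : Type} [Fintype α] (P : α → Prop) : ℤ := ∑ a, if P a then 1 else 0

theorem cnt_eq_natCard {α : Type} [Fintype α] (P : α → Prop) :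
    cnt P = (Nat.card {a // P a} : ℤ) := by
  classical
  rw [Nat.card_eq_fintype_card, Fintype.card_subtype]
  simp [cnt]

theorem cnt_nonneg {α : Type} [Fintype α] (P : α → Prop) : 0 ≤ cnt P := by
  rw [cnt_eq_natCard]; positivity

theorem cnt_congr {α : Type} [Fintype α] {P Q : α → Prop} (h : ∀ a, P a ↔ Q a) :
    cnt P = cnt Q := by
  congr 1; funext a; exact propext (h a)

theorem cnt_split {α : Type} [Fintype α] (P Q : α → Prop) :
    cnt P = cnt (fun a => P a ∧ Q a) + cnt (fun a => P a ∧ ¬ Q a) := by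
  classical
  simp only [cnt, ← Finset.sum_add_distrib]
  refine Finset.sum_congr rfl fun a _ => ?_
  by_cases h1 : P a <;> by_cases h2 : Q a <;> simp [h1, h2]

theorem cnt_or_le {α : Type} [Fintype α] (P Q R : α → Prop) (h : ∀ a, P a → Q a ∨ R a) :
    cnt P ≤ cnt Q + cnt R := by
  classical
  simp only [cnt, ← Finset.sum_add_distrib]
  refine Finset.sum_le_sum fun a _ => ?_
  have := h a
  by_cases h1 : P a <;> by_cases h2 : Q a <;> by_cases h3 : R a <;> simp_all

theorem cnt_disj_le {α : Type} [Fintype α] (P Q R : α → Prop) (hP : ∀ a, P a → R a)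
    (hQ : ∀ a, Q a → R a) (hd : ∀ a, P a → ¬ Q a) :
    cnt P + cnt Q ≤ cnt R := by
  classical
  simp only [cnt, ← Finset.sum_add_distrib]
  refine Finset.sum_le_sum fun a _ => ?_
  have := hP a
  have := hQ a
  have := hd a
  by_cases h1 : P a <;> by_cases h2 : Q a <;> by_cases h3 : R a <;> simp_all

theorem cnt_symm {V : Type} {G : SimpleGraph V} [Fintype G.Dart] (P : G.Dart → Prop) :
    cnt (fun d : G.Dart => P d.symm) = cnt P := by
  classical
  simp only [cnt]
  exact Equiv.sum_comp (dartSymmPerm G) (fun d => if P d then (1 : ℤ) else 0)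

theorem cnt_fst {V : Type} [Fintype V] {G : SimpleGraph V} [Fintype G.Dart] (P : G.Dart → Prop) :
    cnt P = ∑ v : V, cnt (fun d : G.Dart => d.fst = v ∧ P d) := by
  classical
  simp only [cnt]
  rw [Finset.sum_comm]
  refine Finset.sum_congr rfl fun d _ => ?_
  by_cases h : P d <;> simp [h]

open Classical in
theorem cnt_fst_mem {V : Type} [Fintype V] {G : SimpleGraph V} [Fintype G.Dart]
    (P : G.Dart → Prop) (I : Set V) :
    cnt (fun d => d.fst ∈ I ∧ P d) =
      ∑ v : V, if v ∈ I then cnt (fun d : G.Dart => d.fst = v ∧ P d) else 0 := by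
  rw [cnt_fst]
  refine Finset.sum_congr rfl fun v _ => ?_
  split_ifs with h
  · refine cnt_congr fun d => ?_
    constructor
    · rintro ⟨a, b, c⟩; exact ⟨a, c⟩
    · rintro ⟨a, c⟩; exact ⟨a, a ▸ h, c⟩
  · simp only [cnt]
    refine Finset.sum_eq_zero fun d _ => ?_
    rw [if_neg]
    rintro ⟨a, b, c⟩
    exact h (a ▸ b)

theorem cnt_edge {V : Type} [Fintype V] {G : SimpleGraph V} [Fintype G.Dart]
    (A : Set G.edgeSet) :
    cnt (fun d : G.Dart => (⟨d.edge, d.edge_mem⟩ : G.edgeSet) ∈ A) = 2 * (Nat.card A : ℤ) := by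
  classical
  have h1 : (Nat.card A : ℤ) = cnt (fun e : G.edgeSet => e ∈ A) := by
    rw [cnt_eq_natCard]
  rw [h1]
  simp only [cnt]
  rw [Finset.mul_sum, ← Finset.sum_fiberwise (s := Finset.univ)
    (g := fun d : G.Dart => (⟨d.edge, d.edge_mem⟩ : G.edgeSet))]
  refine Finset.sum_congr rfl fun e _ => ?_
  have h2 : ∀ d ∈ Finset.univ.filter (fun d : G.Dart => (⟨d.edge, d.edge_mem⟩ : G.edgeSet) = e),
      (if (⟨d.edge, d.edge_mem⟩ : G.edgeSet) ∈ A then (1 : ℤ) else 0) = if e ∈ A then 1 else 0 := by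
    intro d hd
    rw [(Finset.mem_filter.1 hd).2]
  rw [Finset.sum_congr rfl h2, Finset.sum_const]
  have h3 : (Finset.univ.filter (fun d : G.Dart => (⟨d.edge, d.edge_mem⟩ : G.edgeSet) = e)).card = 2 := by
    obtain ⟨d, hd⟩ := exists_dart_edge e
    have : (Finset.univ.filter (fun d : G.Dart => (⟨d.edge, d.edge_mem⟩ : G.edgeSet) = e))
        = {d, d.symm} := by
      ext d'
      simp only [Finset.mem_filter, Finset.mem_univ, true_and, Finset.mem_insert,
        Finset.mem_singleton, Subtype.ext_iff]
      rw [← hd, SimpleGraph.dart_edge_eq_iff]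
    rw [this, Finset.card_pair (SimpleGraph.Dart.symm_ne d).symm]
  rw [h3]; simp

theorem cnt_small {V : Type} [Fintype V] {G : SimpleGraph V} [Fintype G.Dart]
    (E : PlaneEmb G) (big : G.Dart → Prop) (hcpt : IsCPTLabelling E big)
    (Bs : Set E.Face) (hB : E.outer ∉ Bs) :
    cnt (fun d : G.Dart => E.angleFace d ∈ Bs ∧ ¬ big d) = 3 * (Nat.card Bs : ℤ) := by
  classical
  have : Finite E.Face := Quotient.finite _
  have := Fintype.ofFinite E.Face
  have h1 : (Nat.card Bs : ℤ) = cnt (fun e : E.Face => e ∈ Bs) := by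
    rw [cnt_eq_natCard]
  rw [h1]
  simp only [cnt]
  rw [Finset.mul_sum, ← Finset.sum_fiberwise (s := Finset.univ) (g := fun d => E.angleFace d)]
  refine Finset.sum_congr rfl fun F _ => ?_
  by_cases hF : F ∈ Bs
  · have h3 := hcpt.bounded_small F (fun h => hB (h ▸ hF))
    have h4 : cnt (fun d : G.Dart => E.angleFace d = F ∧ ¬ big d) = 3 := by
      rw [cnt_eq_natCard]
      exact_mod_cast h3
    simp only [hF, if_true, mul_one]
    rw [← h4, cnt, Finset.sum_filter]
    refine Finset.sum_congr rfl fun d _ => ?_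
    by_cases h : E.angleFace d = F <;> simp [h, hF]
  · simp only [hF, if_false, mul_zero]
    refine Finset.sum_eq_zero fun d hd => ?_
    rw [if_neg]
    rintro ⟨h, _⟩
    exact hF ((Finset.mem_filter.1 hd).2 ▸ h)

theorem cnt_big {V : Type} [Fintype V] {G : SimpleGraph V} [Fintype G.Dart]
    (big : G.Dart → Prop) (h1 : ∀ d d' : G.Dart, big d → big d' → d.fst = d'.fst → d = d')
    (Q : G.Dart → Prop) :
    cnt (fun d : G.Dart => big d ∧ Q d) = cnt (fun v : V => ∃ d, big d ∧ Q d ∧ d.fst = v) := by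
  rw [cnt_eq_natCard, cnt_eq_natCard]
  congr 1
  refine Nat.card_congr (Equiv.ofBijective
    (fun d => ⟨d.1.fst, d.1, d.2.1, d.2.2, rfl⟩) ⟨?_, ?_⟩)
  · rintro ⟨d, hd, _⟩ ⟨d', hd', _⟩ h
    exact Subtype.ext (h1 d d' hd hd' (Subtype.ext_iff.1 h))
  · rintro ⟨v, d, hd, hq, rfl⟩
    exact ⟨⟨d, hd, hq⟩, rfl⟩

theorem cnt_true {α : Type} [Fintype α] : cnt (fun _ : α => True) = (Nat.card α : ℤ) := by
  simp [cnt]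

theorem total_count {V : Type} [Fintype V] {G : SimpleGraph V} [Fintype G.Dart]
    (E : PlaneEmb G) (big : G.Dart → Prop) (hcpt : IsCPTLabelling E big) :
    (Nat.card G.edgeSet : ℤ) = 3 * Nat.card V - cnt (PointedVx big) - 3 := by
  classical
  have : Finite E.Face := Quotient.finite _
  have h1 := cnt_edge (G := G) Set.univ
  have h2 := cnt_small E big hcpt {E.outer}ᶜ (by simp)
  have h3 := cnt_big big hcpt.one_big (fun _ => True)
  have h4 := cnt_split (fun d : G.Dart => True) big
  have h5 : cnt (fun d : G.Dart => True ∧ ¬ big d) =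
      cnt (fun d : G.Dart => E.angleFace d ∈ ({E.outer}ᶜ : Set E.Face) ∧ ¬ big d) := by
    refine cnt_congr fun d => ?_
    have := hcpt.outer_big d
    simp only [Set.mem_compl_iff, Set.mem_singleton_iff]
    tauto
  have h6 : cnt (fun d : G.Dart => True ∧ big d) = cnt (fun d : G.Dart => big d ∧ True) :=
    cnt_congr fun d => by tauto
  have h7 : cnt (fun v : V => ∃ d, big d ∧ True ∧ d.fst = v) = cnt (PointedVx big) :=
    cnt_congr fun d => by simp [PointedVx]
  have h8 : cnt (fun d : G.Dart => (⟨d.edge, d.edge_mem⟩ : G.edgeSet) ∈ (Set.univ : Set G.edgeSet))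
    = cnt (fun d : G.Dart => True) := cnt_congr fun d => by simp
  have h9 : Nat.card ({E.outer}ᶜ : Set E.Face) + 1 = Nat.card E.Face := by
    have := Set.ncard_add_ncard_compl ({E.outer} : Set E.Face)
    simp only [Set.ncard_singleton] at this
    rw [← this, Nat.card_coe_set_eq, add_comm]
  have h10 : Nat.card (Set.univ : Set G.edgeSet) = Nat.card G.edgeSet := by simp
  have h11 := E.euler
  have h12 : Nat.card (Quotient (faceSetoid (E.rot * dartSymmPerm G))) = Nat.card E.Face := rfl
  rw [h10] at h1
  omega

/-- the dart lies on both an R-face and a non-R-face -/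
def Mixed {V : Type} {G : SimpleGraph V} (E : PlaneEmb G) (R : Set E.Face) (d : G.Dart) : Prop :=
  ¬ (E.dartFace d ∈ R ↔ E.dartFace d.symm ∈ R)

/-- bridge-like dart -/
def Brid {V : Type} {G : SimpleGraph V} (E : PlaneEmb G) (R : Set E.Face) (A : Set G.edgeSet)
    (d : G.Dart) : Prop :=
  E.dartFace d ∈ R ∧ E.dartFace d.symm ∈ R ∧ (⟨d.edge, d.edge_mem⟩ : G.edgeSet) ∈ A

/-- big angle outside R -/
def BigB {V : Type} {G : SimpleGraph V} (E : PlaneEmb G) (big : G.Dart → Prop) (R : Set E.Face)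
    (v : V) : Prop := ∃ d : G.Dart, big d ∧ E.angleFace d ∉ R ∧ d.fst = v

theorem laman_touch {V : Type} [Fintype V] {G : SimpleGraph V} [Fintype G.Dart]
    (E : PlaneEmb G) (big : G.Dart → Prop) (hcpt : IsCPTLabelling E big) (hgl : GenLaman G big)
    (I : Set V) (hI : 2 ≤ Nat.card (Iᶜ : Set V)) :
    6 * cnt (fun v => v ∈ I) - 2 * cnt (fun v => v ∈ I ∧ PointedVx big v) ≤
      cnt (fun d : G.Dart => d.fst ∈ I ∨ d.snd ∈ I) := by
  classical
  have h1 := hgl Iᶜ hI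
  have h2 := total_count E big hcpt
  have h3 : Nat.card (G.induce Iᶜ).edgeSet =
      Nat.card {e : G.edgeSet | ∀ v ∈ e.1, v ∉ I} := by
    refine Nat.card_congr (Equiv.ofBijective
      (fun e => ⟨⟨e.1.map Subtype.val, ?_⟩, ?_⟩) ⟨?_, ?_⟩)
    · obtain ⟨e, he⟩ := e
      induction e using Sym2.ind with
      | _ a b => exact he
    · obtain ⟨e, he⟩ := e
      intro v hv
      obtain ⟨w, _, rfl⟩ := Sym2.mem_map.1 hv
      exact w.2
    · rintro ⟨e, he⟩ ⟨e', he'⟩ h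
      have h' : e.map Subtype.val = e'.map Subtype.val := congrArg (fun x => x.1.1) h
      exact Subtype.ext (Sym2.map.injective Subtype.val_injective h')
    · rintro ⟨⟨e, he⟩, hv⟩
      induction e using Sym2.ind with
      | _ a b =>
        refine ⟨⟨s(⟨a, hv a (by simp)⟩, ⟨b, hv b (by simp)⟩), he⟩, rfl⟩
  have h4 := cnt_edge {e : G.edgeSet | ∀ v ∈ e.1, v ∉ I}
  have h5 : cnt (fun d : G.Dart => (⟨d.edge, d.edge_mem⟩ : G.edgeSet) ∈
      {e : G.edgeSet | ∀ v ∈ e.1, v ∉ I}) = cnt (fun d : G.Dart => True ∧ ¬ (d.fst ∈ I ∨ d.snd ∈ I)) := by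
    refine cnt_congr fun d => ?_
    obtain ⟨⟨a, b⟩, hab⟩ := d
    simp [SimpleGraph.Dart.edge]
  have h6 := cnt_split (fun d : G.Dart => True) (fun d => d.fst ∈ I ∨ d.snd ∈ I)
  have h7 : cnt (fun d : G.Dart => True ∧ (d.fst ∈ I ∨ d.snd ∈ I)) =
    cnt (fun d : G.Dart => d.fst ∈ I ∨ d.snd ∈ I) := cnt_congr fun d => by tauto
  have h8 := cnt_edge (G := G) Set.univ
  have h9 : cnt (fun d : G.Dart => (⟨d.edge, d.edge_mem⟩ : G.edgeSet) ∈ (Set.univ : Set G.edgeSet))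
    = cnt (fun d : G.Dart => True) := cnt_congr fun d => by simp
  have h10 : Nat.card (Set.univ : Set G.edgeSet) = Nat.card G.edgeSet := by simp
  have h11 : (Nat.card {v ∈ Iᶜ | ¬ PointedVx big v} : ℤ) = cnt (fun v => v ∈ Iᶜ ∧ ¬ PointedVx big v) := by
    rw [cnt_eq_natCard]; rfl
  have h12 : (Nat.card {v ∈ Iᶜ | PointedVx big v} : ℤ) = cnt (fun v => v ∈ Iᶜ ∧ PointedVx big v) := by
    rw [cnt_eq_natCard]; rfl
  have h13 := cnt_split (fun v => v ∈ Iᶜ) (PointedVx big)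
  have h14 := cnt_split (PointedVx big) (fun v => v ∈ I)
  have h15 := cnt_split (fun _ : V => True) (fun v => v ∈ I)
  have h16 : cnt (fun v => True ∧ v ∈ I) = cnt (fun v => v ∈ I) := cnt_congr fun d => by tauto
  have h17 : cnt (fun v => True ∧ ¬ v ∈ I) = cnt (fun v => v ∈ Iᶜ) := cnt_congr fun d => by simp
  have h18 : cnt (fun v => PointedVx big v ∧ v ∈ I) = cnt (fun v => v ∈ I ∧ PointedVx big v) :=
    cnt_congr fun d => by tauto
  have h19 : cnt (fun v => PointedVx big v ∧ ¬ v ∈ I) = cnt (fun v => v ∈ Iᶜ ∧ PointedVx big v) :=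
    cnt_congr fun d => by simp; tauto
  have h20 := cnt_true (α := V)
  have h21 : cnt (fun v => PointedVx big v) = cnt (PointedVx big) := rfl
  rw [h10] at h8
  rw [h3, h11, h12] at h1
  linarith

open Classical in
theorem main_ineq {V : Type} [Fintype V] {G : SimpleGraph V} [Fintype G.Dart]
    (E : PlaneEmb G) (big : G.Dart → Prop) (hcpt : IsCPTLabelling E big) (hgl : GenLaman G big)
    (R : Set E.Face) (hR : E.outer ∈ R) (A : Set G.edgeSet)
    (hA : ∀ d : G.Dart, (⟨d.edge, d.edge_mem⟩ : G.edgeSet) ∉ A → E.dartFace d ∈ R)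
    (T : Set V)
    (hB : ∀ f : E.Face → ZMod 2, (∀ d : G.Dart, (⟨d.edge, d.edge_mem⟩ : G.edgeSet) ∉ A →
      f (E.dartFace d) = f (E.dartFace d.symm)) → ∀ F ∈ R, f F = f E.outer)
    (hT : ∀ g : G.edgeSet → ZMod 2, (∀ e ∉ A, g e = 0) → (∀ v ∈ T, bdry G g v = 0) →
      bdry G g = 0)
    (I : Set V) (hI : 2 ≤ Nat.card (Iᶜ : Set V))
    (hIA : ∀ d : G.Dart, d.fst ∈ I → (⟨d.edge, d.edge_mem⟩ : G.edgeSet) ∈ A) :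
    ∑ v : V, ((if v ∈ I then 6 - (if PointedVx big v then 2 else 0)
        - 2 * cnt (fun d : G.Dart => d.fst = v ∧ Mixed E R d)
        - 2 * cnt (fun d : G.Dart => d.fst = v ∧ Brid E R A d) else 0)
      + 2 * cnt (fun d : G.Dart => d.fst = v ∧ Mixed E R d)
      + 3 * cnt (fun d : G.Dart => d.fst = v ∧ Brid E R A d)
      + (if BigB E big R v then 2 else 0)) ≤ 6 * (Nat.card T : ℤ) := by
  have edge_symm : ∀ d : G.Dart, (⟨d.symm.edge, d.symm.edge_mem⟩ : G.edgeSet) = ⟨d.edge, d.edge_mem⟩ :=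
    fun d => Subtype.ext (SimpleGraph.Dart.edge_symm d)
  have hMs : ∀ d, Mixed E R d.symm ↔ Mixed E R d := by
    intro d; simp only [Mixed, SimpleGraph.Dart.symm_symm]; tauto
  have hBs : ∀ d, Brid E R A d.symm ↔ Brid E R A d := by
    intro d; simp only [Brid, SimpleGraph.Dart.symm_symm, edge_symm]; tauto
  have hpl := planar_bound E A Rᶜ T (fun f hf F hF => hB f hf F (by simpa using hF)) hT
  have hNA := cnt_edge A
  set NA := cnt (fun d : G.Dart => (⟨d.edge, d.edge_mem⟩ : G.edgeSet) ∈ A) with hNAdef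
  -- first count
  have e1 := cnt_split (fun d : G.Dart => (⟨d.edge, d.edge_mem⟩ : G.edgeSet) ∈ A)
    (fun d => E.dartFace d ∈ R)
  have e2 : cnt (fun d : G.Dart => (⟨d.edge, d.edge_mem⟩ : G.edgeSet) ∈ A ∧ ¬ E.dartFace d ∈ R) =
      cnt (fun d : G.Dart => E.dartFace d.symm ∉ R) := by
    rw [cnt_symm (fun d : G.Dart => E.dartFace d ∉ R)]
    refine cnt_congr fun d => ?_
    have := hA d
    tauto
  have e3 := cnt_split (fun d : G.Dart => E.dartFace d.symm ∉ R) big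
  have e4 := cnt_small E big hcpt Rᶜ (by simpa using hR)
  have e5 := cnt_big big hcpt.one_big (fun d => E.dartFace d.symm ∉ R)
  have e6 : cnt (fun d : G.Dart => E.dartFace d.symm ∉ R ∧ big d) =
    cnt (fun d : G.Dart => big d ∧ E.dartFace d.symm ∉ R) := cnt_congr fun d => by tauto
  have e7 : cnt (fun v : V => ∃ d, big d ∧ E.dartFace d.symm ∉ R ∧ d.fst = v) =
    cnt (BigB E big R) := rfl
  have e8 : cnt (fun d : G.Dart => E.angleFace d ∈ Rᶜ ∧ ¬ big d) =
    cnt (fun d : G.Dart => E.dartFace d.symm ∉ R ∧ ¬ big d) := rfl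
  have e9 := cnt_split (fun d : G.Dart => (⟨d.edge, d.edge_mem⟩ : G.edgeSet) ∈ A ∧ E.dartFace d ∈ R)
    (fun d => E.dartFace d.symm ∈ R)
  have e10 : cnt (fun d : G.Dart => ((⟨d.edge, d.edge_mem⟩ : G.edgeSet) ∈ A ∧ E.dartFace d ∈ R) ∧
      E.dartFace d.symm ∈ R) = cnt (Brid E R A) :=
    cnt_congr fun d => by simp only [Brid]; tauto
  have e11 := cnt_split (Mixed E R) (fun d => E.dartFace d ∈ R)
  have e12 : cnt (fun d : G.Dart => ((⟨d.edge, d.edge_mem⟩ : G.edgeSet) ∈ A ∧ E.dartFace d ∈ R) ∧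
      ¬ E.dartFace d.symm ∈ R) = cnt (fun d => Mixed E R d ∧ E.dartFace d ∈ R) := by
    refine cnt_congr fun d => ?_
    have := hA d.symm
    rw [edge_symm] at this
    simp only [Mixed]
    tauto
  have e13 : cnt (fun d => Mixed E R d ∧ ¬ E.dartFace d ∈ R) =
      cnt (fun d => Mixed E R d ∧ E.dartFace d ∈ R) := by
    rw [← cnt_symm]
    refine cnt_congr fun d => ?_
    rw [hMs]
    simp only [Mixed]
    tauto
  have e14 : cnt (fun d => Mixed E R d) = cnt (Mixed E R) := rfl
  -- second count
  have f1 := laman_touch E big hcpt hgl I hI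
  have f2 := cnt_split (fun d : G.Dart => (⟨d.edge, d.edge_mem⟩ : G.edgeSet) ∈ A)
    (fun d => d.fst ∈ I ∨ d.snd ∈ I)
  have f3 : cnt (fun d : G.Dart => (⟨d.edge, d.edge_mem⟩ : G.edgeSet) ∈ A ∧ (d.fst ∈ I ∨ d.snd ∈ I)) =
      cnt (fun d : G.Dart => d.fst ∈ I ∨ d.snd ∈ I) := by
    refine cnt_congr fun d => ?_
    have h1 := hIA d
    have h2 := hIA d.symm
    rw [edge_symm] at h2
    change d.snd ∈ I → _ at h2
    tauto
  have f4 := cnt_disj_le (fun d : G.Dart => Mixed E R d ∧ ¬ (d.fst ∈ I ∨ d.snd ∈ I))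
    (fun d : G.Dart => Brid E R A d ∧ ¬ (d.fst ∈ I ∨ d.snd ∈ I))
    (fun d : G.Dart => (⟨d.edge, d.edge_mem⟩ : G.edgeSet) ∈ A ∧ ¬ (d.fst ∈ I ∨ d.snd ∈ I))
    (by
      rintro d ⟨h1, h2⟩
      refine ⟨?_, h2⟩
      have h3 := hA d
      have h4 := hA d.symm
      rw [edge_symm] at h4
      simp only [Mixed] at h1
      tauto)
    (by
      rintro d ⟨h1, h2⟩
      exact ⟨h1.2.2, h2⟩)
    (by
      rintro d ⟨h1, h2⟩ ⟨h3, h4⟩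
      simp only [Mixed, Brid] at h1 h3
      tauto)
  have touch : ∀ P : G.Dart → Prop, (∀ d, P d.symm ↔ P d) →
      cnt P - 2 * cnt (fun d => d.fst ∈ I ∧ P d) ≤
        cnt (fun d => P d ∧ ¬ (d.fst ∈ I ∨ d.snd ∈ I)) := by
    intro P hP
    have g1 := cnt_split P (fun d => d.fst ∈ I ∨ d.snd ∈ I)
    have g2 := cnt_or_le (fun d => P d ∧ (d.fst ∈ I ∨ d.snd ∈ I)) (fun d => d.fst ∈ I ∧ P d)
      (fun d => d.snd ∈ I ∧ P d) (by intro d; tauto)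
    have g3 : cnt (fun d : G.Dart => d.snd ∈ I ∧ P d) = cnt (fun d : G.Dart => d.fst ∈ I ∧ P d) := by
      rw [← cnt_symm (fun d : G.Dart => d.fst ∈ I ∧ P d)]
      refine cnt_congr fun d => ?_
      rw [hP]; rfl
    have g4 : cnt (fun d => P d) = cnt P := rfl
    linarith
  have f5 := touch _ hMs
  have f6 := touch _ hBs
  -- assemble
  have s1 := cnt_fst (Mixed E R)
  have s2 := cnt_fst (Brid E R A)
  have s3 := cnt_fst_mem (Mixed E R) I
  have s4 := cnt_fst_mem (Brid E R A) I
  have hsum : ∑ v : V, ((if v ∈ I then 6 - (if PointedVx big v then 2 else 0)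
        - 2 * cnt (fun d : G.Dart => d.fst = v ∧ Mixed E R d)
        - 2 * cnt (fun d : G.Dart => d.fst = v ∧ Brid E R A d) else 0)
      + 2 * cnt (fun d : G.Dart => d.fst = v ∧ Mixed E R d)
      + 3 * cnt (fun d : G.Dart => d.fst = v ∧ Brid E R A d)
      + (if BigB E big R v then 2 else 0))
      = 6 * cnt (fun v => v ∈ I) - 2 * cnt (fun v => v ∈ I ∧ PointedVx big v)
        - 2 * cnt (fun d => d.fst ∈ I ∧ Mixed E R d) - 2 * cnt (fun d => d.fst ∈ I ∧ Brid E R A d)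
        + 2 * cnt (Mixed E R) + 3 * cnt (Brid E R A) + 2 * cnt (BigB E big R) := by
    rw [s1, s2, s3, s4, cnt, cnt, cnt.eq_1 (BigB E big R)]
    simp only [Finset.mul_sum, ← Finset.sum_add_distrib, ← Finset.sum_sub_distrib]
    refine Finset.sum_congr rfl fun v _ => ?_
    by_cases h1 : v ∈ I <;> by_cases h2 : PointedVx big v <;> by_cases h3 : BigB E big R v <;>
      simp [h1, h2, h3]
  rw [hsum]
  have hpl' : (Nat.card A : ℤ) ≤ Nat.card (Rᶜ : Set E.Face) + Nat.card T := by exact_mod_cast hpl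
  linarith

end Counting

section Final

open Classical in
/-- vertex weight -/
noncomputable def wt {V : Type} {G : SimpleGraph V} [Fintype G.Dart]
    (E : PlaneEmb G) (big : G.Dart → Prop) (R : Set E.Face) (A : Set G.edgeSet) (I : Set V)
    (v : V) : ℤ :=
  (if v ∈ I then 6 - (if PointedVx big v then 2 else 0)
        - 2 * cnt (fun d : G.Dart => d.fst = v ∧ Mixed E R d)
        - 2 * cnt (fun d : G.Dart => d.fst = v ∧ Brid E R A d) else 0)
      + 2 * cnt (fun d : G.Dart => d.fst = v ∧ Mixed E R d)
      + 3 * cnt (fun d : G.Dart => d.fst = v ∧ Brid E R A d)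
      + (if BigB E big R v then 2 else 0)

theorem cnt_eq_one {α : Type} [Fintype α] (a : α) : cnt (fun x => x = a) = 1 := by
  classical
  simp [cnt]

theorem one_le_cnt {α : Type} [Fintype α] {P : α → Prop} (a : α) (ha : P a) : 1 ≤ cnt P := by
  have h := cnt_disj_le (fun x => x = a) (fun x => False) P (by rintro _ rfl; exact ha)
    (by tauto) (by tauto)
  have h1 := cnt_nonneg (fun x : α => False)
  rw [cnt_eq_one] at h
  linarith

theorem two_le_cnt {α : Type} [Fintype α] {P : α → Prop} (a b : α) (hab : a ≠ b) (ha : P a)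
    (hb : P b) : 2 ≤ cnt P := by
  have h := cnt_disj_le (fun x => x = a) (fun x => x = b) P (by rintro _ rfl; exact ha)
    (by rintro _ rfl; exact hb) (by rintro _ rfl; exact hab)
  rw [cnt_eq_one, cnt_eq_one] at h
  linarith

theorem three_le_cnt {α : Type} [Fintype α] {P : α → Prop} (a b c : α) (hab : a ≠ b)
    (hac : c ≠ a) (hbc : c ≠ b) (ha : P a)
    (hb : P b) (hc : P c) : 3 ≤ cnt P := by
  have h := cnt_disj_le (fun x => x = a ∨ x = b) (fun x => x = c) P
    (by rintro _ (rfl | rfl) <;> assumption)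
    (by rintro _ rfl; exact hc) (by rintro _ (rfl | rfl) h <;> exact absurd h.symm (by assumption))
  have h2 := two_le_cnt (P := fun x => x = a ∨ x = b) a b hab (Or.inl rfl) (Or.inr rfl)
  rw [cnt_eq_one] at h
  linarith

theorem uni {V : Type} {G : SimpleGraph V} (E : PlaneEmb G) (R : Set E.Face) (v : V)
    (h : ∀ d : G.Dart, d.fst = v → ¬ Mixed E R d) (d d' : G.Dart) (hd : d.fst = v)
    (hd' : d'.fst = v) (hP : E.dartFace d ∈ R) : E.dartFace d' ∈ R := by
  have := rot_closed E (fun e => e.fst = v ∧ E.dartFace e ∈ R) (by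
    rintro e ⟨h1, h2⟩
    refine ⟨(E.rot_fst e).trans h1, ?_⟩
    rw [dartFace_rot]
    have := h e h1
    simp only [Mixed, not_not] at this
    exact this.1 h2) d d' (hd.trans hd'.symm) ⟨hd, hP⟩
  exact this.2

theorem two_mixed {V : Type} {G : SimpleGraph V} [Fintype G.Dart] (E : PlaneEmb G)
    (R : Set E.Face) (v : V) (d : G.Dart) (hd : d.fst = v) (hm : Mixed E R d) :
    2 ≤ cnt (fun d : G.Dart => d.fst = v ∧ Mixed E R d) := by
  by_cases hP : E.dartFace d ∈ R
  · have hs : E.dartFace d.symm ∉ R := fun h => hm ⟨fun _ => h, fun _ => hP⟩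
    have : ∃ d' : G.Dart, d'.fst = v ∧ E.dartFace d' ∉ R ∧ E.dartFace d'.symm ∈ R := by
      by_contra hcon
      push Not at hcon
      have := rot_closed E (fun e => e.fst = v ∧ E.dartFace e ∉ R) (by
        rintro e ⟨h1, h2⟩
        exact ⟨(E.rot_fst e).trans h1, by rw [dartFace_rot]; exact hcon e h1 h2⟩)
        (E.rot d) d (E.rot_fst d) ⟨(E.rot_fst d).trans hd, by rwa [dartFace_rot]⟩
      exact this.2 hP
    obtain ⟨d', h1, h2, h3⟩ := this
    refine two_le_cnt d d' ?_ ⟨hd, hm⟩ ⟨h1, fun h => h2 (h.2 h3)⟩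
    rintro rfl
    exact h2 hP
  · have hs : E.dartFace d.symm ∈ R := by
      by_contra h
      exact hm ⟨fun a => absurd a hP, fun a => absurd a h⟩
    have : ∃ d' : G.Dart, d'.fst = v ∧ E.dartFace d' ∈ R ∧ E.dartFace d'.symm ∉ R := by
      by_contra hcon
      push Not at hcon
      have := rot_closed E (fun e => e.fst = v ∧ E.dartFace e ∈ R) (by
        rintro e ⟨h1, h2⟩
        exact ⟨(E.rot_fst e).trans h1, by rw [dartFace_rot]; exact hcon e h1 h2⟩)
        (E.rot d) d (E.rot_fst d) ⟨(E.rot_fst d).trans hd, by rwa [dartFace_rot]⟩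
      exact hP this.2
    obtain ⟨d', h1, h2, h3⟩ := this
    refine two_le_cnt d d' ?_ ⟨hd, hm⟩ ⟨h1, fun h => h3 (h.1 h2)⟩
    rintro rfl
    exact hP h2

theorem sum_bdry {V : Type} [Fintype V] (G : SimpleGraph V) (g : G.edgeSet → ZMod 2) :
    ∑ v, bdry G g v = 0 := by
  classical
  simp only [bdry_apply]
  rw [Finset.sum_comm]
  simp only [Finset.sum_ite_eq, Finset.mem_univ, if_true]
  refine Finset.sum_involution (fun d _ => d.symm) ?_ ?_ ?_ ?_
  · intro d _
    have : (⟨d.symm.edge, d.symm.edge_mem⟩ : G.edgeSet) = ⟨d.edge, d.edge_mem⟩ :=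
      Subtype.ext (SimpleGraph.Dart.edge_symm d)
    rw [this]
    exact CharTwo.add_self_eq_zero _
  · intro d _ _
    exact SimpleGraph.Dart.symm_ne d
  · simp
  · intro d _; exact SimpleGraph.Dart.symm_symm d

theorem core {V : Type} [Fintype V] {G : SimpleGraph V} [Fintype G.Dart]
    (E : PlaneEmb G) (big : G.Dart → Prop) (hcpt : IsCPTLabelling E big)
    (hgl : GenLaman G big) (H : G.Subgraph) (hH : 3 ≤ Nat.card H.verts) :
    3 ≤ cnt (fun v => IsCPTCorner E big H v) := by
  classical
  set C : V → Prop := fun v => IsCPTCorner E big H v with hC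
  obtain ⟨R, hRdef⟩ : ∃ R : Set E.Face, R = {F | InOuterOf E H.edgeSet F} := ⟨_, rfl⟩
  have hRi : ∀ F, InOuterOf E H.edgeSet F ↔ F ∈ R := by intro F; rw [hRdef]; rfl
  have hRo : E.outer ∈ R := (hRi _).1 Relation.ReflTransGen.refl
  have hstep1 : ∀ d : G.Dart, d.edge ∉ H.edgeSet → E.dartFace d.symm ∈ R → E.dartFace d ∈ R := by
    intro d hd h
    rw [← hRi] at h ⊢
    exact Relation.ReflTransGen.head ⟨d, rfl, rfl, hd⟩ h
  have hstep : ∀ d : G.Dart, d.edge ∉ H.edgeSet → ¬ Mixed E R d := by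
    intro d hd hm
    apply hm
    refine ⟨fun h => ?_, hstep1 d hd⟩
    apply hstep1 d.symm
    · rwa [SimpleGraph.Dart.edge_symm]
    · rwa [SimpleGraph.Dart.symm_symm]
  obtain ⟨A, hAdef⟩ : ∃ A : Set G.edgeSet, ∀ d : G.Dart, (⟨d.edge, d.edge_mem⟩ : G.edgeSet) ∈ A ↔
      (d.edge ∈ H.edgeSet ∨ E.dartFace d ∉ R ∨ E.dartFace d.symm ∉ R) := by
    refine ⟨{e | e.1 ∈ H.edgeSet ∨ ∃ d : G.Dart, d.edge = e.1 ∧ E.dartFace d ∉ R}, fun d => ?_⟩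
    simp only [Set.mem_setOf_eq]
    refine or_congr Iff.rfl ?_
    constructor
    · rintro ⟨d', h1, h2⟩
      rcases (SimpleGraph.dart_edge_eq_iff _ _).1 h1 with rfl | rfl
      · exact Or.inl h2
      · exact Or.inr h2
    · rintro (h | h)
      · exact ⟨d, rfl, h⟩
      · exact ⟨d.symm, SimpleGraph.Dart.edge_symm d, h⟩
  have hA : ∀ d : G.Dart, (⟨d.edge, d.edge_mem⟩ : G.edgeSet) ∉ A → E.dartFace d ∈ R := by
    intro d hd
    rw [hAdef] at hd
    tauto
  have hB : ∀ f : E.Face → ZMod 2, (∀ d : G.Dart, (⟨d.edge, d.edge_mem⟩ : G.edgeSet) ∉ A →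
      f (E.dartFace d) = f (E.dartFace d.symm)) → ∀ F ∈ R, f F = f E.outer := by
    intro f hf F hF
    rw [← hRi] at hF
    induction hF using Relation.ReflTransGen.head_induction_on with
    | refl => rfl
    | head hs ht ih =>
      rw [← ih]
      have h1 := Relation.ReflTransGen.head hs ht
      have ht' := (hRi _).1 ht
      have h1' := (hRi _).1 h1
      obtain ⟨d, rfl, rfl, hd⟩ := hs
      apply hf
      rw [hAdef]
      tauto
  obtain ⟨V2, hV2⟩ : ∃ V2 : Set V, ∀ v, v ∈ V2 ↔
      ∃ d : G.Dart, d.fst = v ∧ (⟨d.edge, d.edge_mem⟩ : G.edgeSet) ∈ A := ⟨_, fun v => Iff.rfl⟩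
  obtain ⟨I, hIdef⟩ : ∃ I : Set V, ∀ v, v ∈ I ↔ (v ∈ V2 ∧ ¬ C v ∧
      (¬ PointedVx big v ∨ ∀ d : G.Dart, d.fst = v → E.dartFace d ∉ R)) := ⟨_, fun v => Iff.rfl⟩
  have hang : ∀ d : G.Dart, E.angleFace d = E.dartFace d.symm := fun d => rfl
  -- vertices outside H
  have hnotH : ∀ v, v ∉ H.verts → ∀ d : G.Dart, d.fst = v → d.edge ∉ H.edgeSet := by
    rintro v hv d rfl h
    exact hv (H.mem_verts_of_mem_edge h (by
      change d.fst ∈ s(d.fst, d.snd)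
      exact Sym2.mem_mk_left _ _))
  have hnotH' : ∀ v, v ∉ H.verts → v ∈ V2 → ∀ d : G.Dart, d.fst = v → E.dartFace d ∉ R := by
    intro v hv hv2 d hd hdR
    have hm : ∀ e : G.Dart, e.fst = v → ¬ Mixed E R e := fun e he => hstep e (hnotH v hv e he)
    obtain ⟨e, he, heA⟩ := (hV2 v).1 hv2
    rw [hAdef] at heA
    have h1 := uni E R v hm d e hd he hdR
    have h2 := hm e he
    simp only [Mixed, not_not] at h2
    have h3 := hnotH v hv e he
    tauto
  have hrotinv : ∀ d : G.Dart, ∃ d0 : G.Dart, E.rot d0 = d ∧ d0.fst = d.fst := by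
    intro d
    refine ⟨E.rot.symm d, by simp, ?_⟩
    rw [← E.rot_fst]; simp
  have hcornN : ∀ v, v ∈ H.verts → ¬ PointedVx big v → ∀ d : G.Dart, d.fst = v →
      (⟨d.edge, d.edge_mem⟩ : G.edgeSet) ∉ A → C v := by
    intro v hv hp d hd hdA
    rw [hAdef] at hdA
    push Not at hdA
    obtain ⟨d0, h0, h0'⟩ := hrotinv d
    refine Or.inr ⟨hv, hp, d0, h0'.trans hd, ?_, ?_, ?_⟩
    · rw [hRi, hang, ← dartFace_rot, h0]; exact hdA.2.1
    · rw [hRi, h0]; exact hdA.2.2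
    · rw [h0]; exact hdA.1
  have hIA : ∀ d : G.Dart, d.fst ∈ I → (⟨d.edge, d.edge_mem⟩ : G.edgeSet) ∈ A := by
    intro d hd
    obtain ⟨h1, h2, h3⟩ := (hIdef _).1 hd
    by_contra hcon
    have hdR := hA d hcon
    by_cases hv : d.fst ∈ H.verts
    · rcases h3 with h3 | h3
      · exact h2 (hcornN _ hv h3 d rfl hcon)
      · exact h3 d rfl hdR
    · exact hnotH' _ hv h1 d rfl hdR
  have houtI : ∀ d : G.Dart, E.dartFace d.symm = E.outer → d.fst ∉ I := by
    intro d hd hI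
    obtain ⟨h1, h2, h3⟩ := (hIdef _).1 hI
    rcases h3 with h3 | h3
    · exact h3 ⟨d, hcpt.outer_big d hd, rfl⟩
    · refine h3 (E.rot d) (E.rot_fst d) ?_
      rw [dartFace_rot, hd]; exact hRo
  have hI : 2 ≤ Nat.card (Iᶜ : Set V) := by
    obtain ⟨d0, hd0⟩ := Quotient.exists_rep E.outer
    have hd0 : E.dartFace d0 = E.outer := hd0
    have h1 := houtI d0.symm (by rw [SimpleGraph.Dart.symm_symm, hd0])
    have h2 := houtI (E.rot d0.symm).symm (by
      rw [SimpleGraph.Dart.symm_symm, dartFace_rot, SimpleGraph.Dart.symm_symm, hd0])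
    have h3 : d0.symm.fst ≠ (E.rot d0.symm).symm.fst := by
      rw [← E.rot_fst d0.symm]
      exact (E.rot d0.symm).fst_ne_snd
    have h4 := two_le_cnt (P := fun v => v ∈ Iᶜ) _ _ h3 h1 h2
    rw [cnt_eq_natCard] at h4
    exact_mod_cast h4
  have hmain : ∀ T : Set V, (∀ g : G.edgeSet → ZMod 2, (∀ e ∉ A, g e = 0) →
      (∀ v ∈ T, bdry G g v = 0) → bdry G g = 0) →
      ∑ v, wt E big R A I v ≤ 6 * cnt (fun v => v ∈ T) := by
    intro T hT
    have := main_ineq E big hcpt hgl R hRo A hA T hB hT I hI hIA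
    rw [cnt_eq_natCard]
    exact this
  obtain ⟨t1, ht1⟩ : ∃ t1 : V → ℤ, ∀ v, t1 v = cnt (fun d : G.Dart => d.fst = v ∧ Mixed E R d) :=
    ⟨_, fun _ => rfl⟩
  obtain ⟨t2, ht2⟩ : ∃ t2 : V → ℤ, ∀ v, t2 v = cnt (fun d : G.Dart => d.fst = v ∧ Brid E R A d) :=
    ⟨_, fun _ => rfl⟩
  have ht1n : ∀ v, 0 ≤ t1 v := fun v => by rw [ht1]; exact cnt_nonneg _
  have ht2n : ∀ v, 0 ≤ t2 v := fun v => by rw [ht2]; exact cnt_nonneg _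
  have hwt : ∀ v, wt E big R A I v = (if v ∈ I then 6 - (if PointedVx big v then 2 else 0)
        - 2 * t1 v - 2 * t2 v else 0) + 2 * t1 v + 3 * t2 v + (if BigB E big R v then 2 else 0) := by
    intro v
    rw [ht1, ht2, wt]
  have hCR : ∀ v, C v → ∃ d : G.Dart, d.fst = v ∧ E.dartFace d ∈ R := by
    rintro v (⟨_, d, _, h2, h3⟩ | ⟨_, _, d, h2, h3, _⟩)
    all_goals
      refine ⟨E.rot d, (E.rot_fst d).trans h2, ?_⟩
      rw [dartFace_rot]
      exact (hRi _).1 h3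
  -- nonmixed corner: all A-darts are bridges
  have hbr : ∀ v, C v → t1 v < 2 → ∀ d : G.Dart, d.fst = v →
      (⟨d.edge, d.edge_mem⟩ : G.edgeSet) ∈ A → Brid E R A d := by
    intro v hCv h1 d hd hdA
    have hm : ∀ e : G.Dart, e.fst = v → ¬ Mixed E R e := by
      intro e he hme
      have := two_mixed E R v e he hme
      rw [← ht1] at this
      linarith
    obtain ⟨e, he, heR⟩ := hCR v hCv
    have h2 := uni E R v hm e d he hd heR
    have h3 := hm d hd
    simp only [Mixed, not_not] at h3
    exact ⟨h2, h3.1 h2, hdA⟩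
  have hw0 : ∀ v, v ∉ V2 → 0 ≤ wt E big R A I v := by
    intro v hv
    have : v ∉ I := fun h => hv ((hIdef v).1 h).1
    rw [hwt, if_neg this]
    have := ht1n v
    have := ht2n v
    split_ifs <;> linarith
  have hwC : ∀ v, v ∈ V2 → C v → 2 * t1 v + 3 * t2 v ≤ wt E big R A I v := by
    intro v hv hCv
    have : v ∉ I := fun h => ((hIdef v).1 h).2.1 hCv
    rw [hwt, if_neg this]
    split_ifs <;> linarith
  have hC3 : ∀ v, v ∈ V2 → C v → 3 ≤ 2 * t1 v + 3 * t2 v := by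
    intro v hv hCv
    have h1 := ht1n v
    have h2 := ht2n v
    by_cases h : t1 v < 2
    · obtain ⟨d, hd, hdA⟩ := (hV2 v).1 hv
      have h3 := hbr v hCv h d hd hdA
      have h4 := one_le_cnt (P := fun d : G.Dart => d.fst = v ∧ Brid E R A d) d ⟨hd, h3⟩
      rw [← ht2] at h4
      linarith
    · linarith
  have hwN : ∀ v, v ∈ V2 → ¬ C v → 6 + t2 v ≤ wt E big R A I v := by
    intro v hv hCv
    have h1 := ht1n v
    have h2 := ht2n v
    rw [hwt]
    by_cases hvI : v ∈ I
    · rw [if_pos hvI]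
      by_cases hp : PointedVx big v
      · have hall := ((hIdef v).1 hvI).2.2.resolve_left (not_not.2 hp)
        obtain ⟨d, hd, hdv⟩ := hp
        have hBB : BigB E big R v := by
          refine ⟨d, hd, ?_, hdv⟩
          rw [hang, ← dartFace_rot]
          exact hall _ ((E.rot_fst d).trans hdv)
        rw [if_pos ⟨d, hd, hdv⟩, if_pos hBB]
        linarith
      · rw [if_neg hp]
        split_ifs <;> linarith
    · rw [if_neg hvI]
      have h3 : ¬ (¬ PointedVx big v ∨ ∀ d : G.Dart, d.fst = v → E.dartFace d ∉ R) :=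
        fun h => hvI ((hIdef v).2 ⟨hv, hCv, h⟩)
      push Not at h3
      obtain ⟨⟨b, hb, hbv⟩, d, hd, hdR⟩ := h3
      have hvH : v ∈ H.verts := by
        by_contra hvH
        exact hnotH' v hvH hv d hd hdR
      have hbR : E.angleFace b ∉ R := by
        intro h
        exact hCv (Or.inl ⟨hvH, b, hb, hbv, (hRi _).2 h⟩)
      rw [if_pos ⟨b, hb, hbR, hbv⟩]
      have hmix : ∃ e : G.Dart, e.fst = v ∧ Mixed E R e := by
        by_contra hcon
        push Not at hcon
        have := uni E R v hcon d (E.rot b) hd ((E.rot_fst b).trans hbv) hdR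
        rw [dartFace_rot] at this
        exact hbR this
      obtain ⟨e, he, hme⟩ := hmix
      have := two_mixed E R v e he hme
      rw [← ht1] at this
      linarith
  -- isolated vertices
  have hdart : ∀ v : V, ∃ d : G.Dart, d.fst = v := by
    intro v
    have hnt : Nontrivial V := by
      have h1 : Nat.card H.verts ≤ Nat.card V := Nat.card_le_card_of_injective _ Subtype.val_injective
      rw [← Finite.one_lt_card_iff_nontrivial]
      omega
    obtain ⟨w, hw⟩ := E.connected.preconnected.exists_adj_of_nontrivial v
    exact ⟨⟨(v, w), hw⟩, rfl⟩
  have hiso : ∀ v, v ∈ H.verts → v ∉ V2 → C v := by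
    intro v hv hv2
    have hnA : ∀ d : G.Dart, d.fst = v → (⟨d.edge, d.edge_mem⟩ : G.edgeSet) ∉ A := by
      intro d hd h
      exact hv2 ((hV2 v).2 ⟨d, hd, h⟩)
    by_cases hp : PointedVx big v
    · obtain ⟨b, hb, hbv⟩ := hp
      refine Or.inl ⟨hv, b, hb, hbv, (hRi _).2 ?_⟩
      have := hnA b hbv
      rw [hAdef] at this
      rw [hang]
      tauto
    · obtain ⟨d, hd⟩ := hdart v
      exact hcornN v hv hp d hd (hnA d hd)
  -- boundary facts
  have hbd0 : ∀ g : G.edgeSet → ZMod 2, (∀ e ∉ A, g e = 0) → ∀ v ∉ V2, bdry G g v = 0 := by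
    intro g hg v hv
    rw [bdry_apply]
    refine Finset.sum_eq_zero fun d _ => ?_
    split_ifs with h
    · apply hg
      intro h'
      exact hv ((hV2 v).2 ⟨d, h, h'⟩)
    · rfl
  have hbd1 : ∀ g : G.edgeSet → ZMod 2, ∀ v0, (∀ v, v ≠ v0 → bdry G g v = 0) → bdry G g = 0 := by
    intro g v0 h
    have h1 := sum_bdry G g
    rw [Fintype.sum_eq_single v0 h] at h1
    funext v
    by_cases hv : v = v0
    · rw [hv, h1]; rfl
    · exact h v hv
  by_contra hlt
  push Not at hlt
  have hHc : 3 ≤ cnt (fun v => v ∈ H.verts) := by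
    rw [cnt_eq_natCard]; exact_mod_cast hH
  have hV2ne : ∃ v0, v0 ∈ V2 := by
    by_contra hcon
    push Not at hcon
    have h1 := cnt_or_le (fun v => v ∈ H.verts) C (fun _ => False)
      (fun v hv => Or.inl (hiso v hv (hcon v)))
    have h2 : cnt (fun _ : V => False) = 0 := by simp [cnt]
    linarith
  obtain ⟨n2, hn2⟩ : ∃ n2, n2 = cnt (fun v => v ∈ V2) := ⟨_, rfl⟩
  obtain ⟨k2, hk2⟩ : ∃ k2, k2 = cnt (fun v => v ∈ V2 ∧ C v) := ⟨_, rfl⟩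
  have hup : ∑ v, wt E big R A I v ≤ 6 * (n2 - 1) := by
    obtain ⟨v0, hv0⟩ := hV2ne
    have h1 := hmain (V2 \ {v0}) (by
      intro g hg h
      refine hbd1 g v0 fun v hv => ?_
      by_cases hv2 : v ∈ V2
      · exact h v ⟨hv2, hv⟩
      · exact hbd0 g hg v hv2)
    have h2 := cnt_disj_le (fun v => v ∈ V2 \ {v0}) (fun v => v = v0) (fun v => v ∈ V2)
      (fun v hv => hv.1) (by rintro _ rfl; exact hv0) (fun v hv => hv.2)
    rw [cnt_eq_one, ← hn2] at h2
    linarith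
  obtain ⟨u, hu⟩ : ∃ u : V → ℤ, ∀ v, u v = wt E big R A I v - 6 * (if v ∈ V2 then 1 else 0)
      + 3 * (if v ∈ V2 ∧ C v then 1 else 0) := ⟨_, fun _ => rfl⟩
  have hu0 : ∀ v, 0 ≤ u v := by
    intro v
    rw [hu]
    by_cases hv : v ∈ V2
    · by_cases hc : C v
      · have := hwC v hv hc
        have := hC3 v hv hc
        simp only [hv, hc, and_self, if_true]
        linarith
      · have := hwN v hv hc
        have := ht2n v
        simp only [hv, hc, and_false, if_true, if_false]
        linarith
    · have := hw0 v hv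
      simp only [hv, false_and, if_false]
      linarith
  have hsu : ∑ v, u v = ∑ v, wt E big R A I v - 6 * n2 + 3 * k2 := by
    rw [hn2, hk2]
    simp only [cnt, Finset.mul_sum, ← Finset.sum_add_distrib, ← Finset.sum_sub_distrib]
    refine Finset.sum_congr rfl fun v _ => ?_
    rw [hu]
    congr
  have hsu0 : 0 ≤ ∑ v, u v := Finset.sum_nonneg fun v _ => hu0 v
  have hCsplit := cnt_split C (fun v => v ∈ V2)
  have hCs1 : cnt (fun v => C v ∧ v ∈ V2) = k2 := by
    rw [hk2]; exact cnt_congr fun v => and_comm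
  have hCs2 := cnt_nonneg (fun v => C v ∧ ¬ v ∈ V2)
  have hCC : cnt (fun v => C v) = cnt C := rfl
  have hk : k2 = 2 := by omega
  have hj : cnt (fun v => C v ∧ ¬ v ∈ V2) = 0 := by omega
  have hCV : ∀ v, C v → v ∈ V2 := by
    intro v hv
    by_contra h
    have := one_le_cnt (P := fun v => C v ∧ ¬ v ∈ V2) v ⟨hv, h⟩
    omega
  have huz : ∀ v, u v = 0 := by
    have : ∑ v, u v = 0 := by linarith
    have := (Finset.sum_eq_zero_iff_of_nonneg fun v _ => hu0 v).1 this
    exact fun v => this v (Finset.mem_univ v)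
  have hCt : ∀ v, C v → t1 v = 0 ∧ t2 v = 1 := by
    intro v hc
    have hv := hCV v hc
    have h1 := huz v
    rw [hu] at h1
    simp only [hv, hc, and_self, if_true] at h1
    have h2 := hwC v hv hc
    have h3 := hC3 v hv hc
    have h4 := ht1n v
    have h5 := ht2n v
    omega
  have hNt : ∀ v, ¬ C v → t2 v ≤ 0 := by
    intro v hc
    by_cases hv : v ∈ V2
    · have h1 := huz v
      rw [hu] at h1
      simp only [hv, hc, and_false, if_true, if_false] at h1
      have h2 := hwN v hv hc
      omega
    · rw [ht2]
      have : cnt (fun d : G.Dart => d.fst = v ∧ Brid E R A d) = cnt (fun d : G.Dart => False) := by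
        refine cnt_congr fun d => ?_
        simp only [iff_false]
        rintro ⟨h1, h2⟩
        exact hv ((hV2 v).2 ⟨d, h1, h2.2.2⟩)
      rw [this]
      simp [cnt]
  obtain ⟨a, ha⟩ : ∃ a, C a := by
    by_contra hcon
    push Not at hcon
    have : cnt (fun v => v ∈ V2 ∧ C v) = cnt (fun v : V => False) :=
      cnt_congr fun v => by simp [hcon v]
    have h2 : cnt (fun _ : V => False) = 0 := by simp [cnt]
    omega
  -- bridge at a
  obtain ⟨da, hda, hdaA⟩ := (hV2 a).1 (hCV a ha)
  have hdaB := hbr a ha (by rw [(hCt a ha).1]; norm_num) da hda hdaA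
  have hedges : (⟨da.symm.edge, da.symm.edge_mem⟩ : G.edgeSet) = ⟨da.edge, da.edge_mem⟩ :=
    Subtype.ext (SimpleGraph.Dart.edge_symm da)
  have hdaB' : Brid E R A da.symm := by
    refine ⟨hdaB.2.1, ?_, ?_⟩
    · rw [SimpleGraph.Dart.symm_symm]; exact hdaB.1
    · rw [hedges]; exact hdaB.2.2
  obtain ⟨b, hbdef⟩ : ∃ b, b = da.snd := ⟨_, rfl⟩
  have hdb : da.symm.fst = b := hbdef.symm
  have hb : C b := by
    by_contra hb
    have h1 := hNt b hb
    have h2 := one_le_cnt (P := fun d : G.Dart => d.fst = b ∧ Brid E R A d) da.symm ⟨hdb, hdaB'⟩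
    rw [← ht2] at h2
    linarith
  have hab : a ≠ b := by
    rw [hbdef, ← hda]
    exact da.fst_ne_snd
  have hbdry : ∀ v, C v → ∀ e : G.Dart, e.fst = v → Brid E R A e → ∀ g : G.edgeSet → ZMod 2,
      (∀ e ∉ A, g e = 0) → bdry G g v = g ⟨e.edge, e.edge_mem⟩ := by
    intro v hv e he heB g hg
    rw [bdry_apply, Finset.sum_eq_single e]
    · rw [if_pos he]
    · intro d _ hde
      split_ifs with h
      · apply hg
        intro hdA
        have h1 := hbr v hv (by rw [(hCt v hv).1]; norm_num) d h hdA
        have h2 := two_le_cnt (P := fun d : G.Dart => d.fst = v ∧ Brid E R A d) d e hde ⟨h, h1⟩ ⟨he, heB⟩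
        rw [← ht2, (hCt v hv).2] at h2
        norm_num at h2
      · rfl
    · intro h; exact absurd (Finset.mem_univ e) h
  have hv0 : ∃ v0, v0 ∈ V2 ∧ v0 ≠ a ∧ v0 ≠ b := by
    by_contra hcon
    push Not at hcon
    have h1 := cnt_or_le (fun v => v ∈ H.verts) (fun v => v = a) (fun v => v = b) (by
      intro v hv
      have hv2 : v ∈ V2 := by
        by_contra h
        exact h (hCV v (hiso v hv h))
      have := hcon v hv2
      tauto)
    rw [cnt_eq_one, cnt_eq_one] at h1
    linarith
  obtain ⟨v0, hv0, hv0a, hv0b⟩ := hv0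
  have h1 := hmain (V2 \ {v0, a}) (by
    intro g hg h
    have hgb : bdry G g b = 0 := h b ⟨hCV b hb, by
      simp only [Set.mem_insert_iff, Set.mem_singleton_iff, not_or]
      exact ⟨hv0b.symm, hab.symm⟩⟩
    have hga : bdry G g a = 0 := by
      rw [hbdry a ha da hda hdaB g hg]
      rw [hbdry b hb da.symm hdb hdaB' g hg, hedges] at hgb
      exact hgb
    refine hbd1 g v0 fun v hv => ?_
    by_cases hva : v = a
    · rw [hva, hga]
    by_cases hv2 : v ∈ V2
    · exact h v ⟨hv2, by simp [hv, hva]⟩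
    · exact hbd0 g hg v hv2)
  have h2 := cnt_disj_le (fun v => v ∈ V2 \ {v0, a}) (fun v => v = v0 ∨ v = a) (fun v => v ∈ V2)
    (fun v hv => hv.1) (by rintro _ (rfl | rfl); exacts [hv0, hCV _ ha])
    (fun v hv => by simpa using hv.2)
  have h3 := two_le_cnt (P := fun v => v = v0 ∨ v = a) v0 a hv0a (Or.inl rfl) (Or.inr rfl)
  rw [← hn2] at h2
  linarith

end Final

/-- **Theorem 7, part 2.** In a combinatorial pseudo-triangulation with the generalized Laman
property, every subgraph with at least three vertices has at least three corners. -/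
theorem genLaman_cpt_three_corners
    {V : Type} [Fintype V] [DecidableEq V] (G : SimpleGraph V)
    (E : PlaneEmb G) (big : G.Dart → Prop) (hcpt : IsCPTLabelling E big)
    (hgl : GenLaman G big) :
    ∀ H : G.Subgraph, 3 ≤ Nat.card H.verts →
      3 ≤ Nat.card {v : V | IsCPTCorner E big H v} := by
  intro H hH
  have := Fintype.ofFinite G.Dart
  have h := core E big hcpt hgl H hH
  rw [cnt_eq_natCard] at h
  exact_mod_cast h
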